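/- Let S' be any ℤ-submodule of the ℚ-span of S containing S such that ⟨u,v⟩ ∈ ℤ for all u,v ∈ S', ⟨u,u⟩ ∈ 2ℤ for all u ∈ S' (S' is an even overlattice of S), S' ∩ (ℚ-span of Ω) = Ω, and S' ∩ ℚℓ = ℤℓ. Then the index [S' : S] equals 1, 2 or 4. Moreover, such an S' of index 2 exists if and only if d is even, and such an S' of index 4 exists if and only if d ≡ 4 or 12 (mod 16). -/

import Mathlib

/- Context: V ⊕ ℚℓ = ℚ^23 (ℓ = coordinate 22) with the Gram matrix of the
paper extended by ⟨ℓ,ℓ⟩ = 2d, Ω = Ω_{2,2} the co-invariant lattice, and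
S = Ω + ℤℓ. -/

noncomputable section
open Matrix

abbrev V : Type := Fin 23 → ℚ

/-- Gram matrix of V ⊕ ℚℓ, depending on d. -/
def gramX (d : ℤ) : Matrix (Fin 23) (Fin 23) ℚ := Matrix.of fun i j =>
  if i.val = 22 ∨ j.val = 22 then (if i = j then 2 * (d : ℚ) else 0)
  else if i = j then
    (if i.val < 16 then -2 else if i.val < 18 then -4 else if i.val < 20 then 0 else 4)
  else if i.val / 2 = j.val / 2 then
    (if i.val < 16 then 1 else if i.val < 18 then 2 else if i.val < 20 then 3 else 2)
  else 0

def B (d : ℤ) (u v : V) : ℚ := u ⬝ᵥ (gramX d *ᵥ v)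

def bv : Fin 23 → V := fun i j => if i = j then 1 else 0

def ΩGens : Set V :=
  {bv 16, bv 17,
   bv 10 - bv 8, bv 11 - bv 9, bv 14 - bv 12, bv 15 - bv 13,
   bv 2 - bv 0, bv 0 - bv 4, bv 4 - bv 6, bv 1 - bv 3, bv 5 - bv 1, bv 7 - bv 5,
   (1/3 : ℚ) • (bv 0 - bv 2 - bv 4 + bv 6 - bv 1 + bv 3 + bv 5 - bv 7 + bv 16 - bv 17),
   (1/3 : ℚ) • (-(bv 0) + bv 6 + bv 1 - bv 7 - bv 8 + bv 10 + bv 9 - bv 11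
      - bv 12 + bv 14 + bv 13 - bv 15),
   (1/3 : ℚ) • (bv 0 + bv 2 - bv 4 - bv 6 - bv 1 - bv 3 + bv 5 + bv 7
      - bv 8 + bv 10 + bv 9 - bv 11)}

def Ω : Submodule ℤ V := Submodule.span ℤ ΩGens

/-- the polarization class ℓ with ℓ² = 2d -/
def ℓv : V := bv 22

/-- S = Ω ⊕ ℤℓ -/
def S : Submodule ℤ V := Ω ⊔ Submodule.span ℤ {ℓv}

/-- S' is an admissible overlattice of S: an even overlattice of S inside the
ℚ-span of S, with S' ∩ (ℚ-span of Ω) = Ω and S' ∩ ℚℓ = ℤℓ. -/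
def IsAdmissible (d : ℤ) (S' : Submodule ℤ V) : Prop :=
  S ≤ S' ∧
  S' ≤ (Submodule.span ℚ (S : Set V)).restrictScalars ℤ ∧
  (∀ u ∈ S', ∀ v ∈ S', ∃ n : ℤ, B d u v = (n : ℚ)) ∧
  (∀ u ∈ S', ∃ n : ℤ, B d u u = 2 * (n : ℚ)) ∧
  S' ⊓ (Submodule.span ℚ (Ω : Set V)).restrictScalars ℤ = Ω ∧
  S' ⊓ (Submodule.span ℚ {ℓv}).restrictScalars ℤ = Submodule.span ℤ {ℓv}

/-- the index [S' : S] -/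
def idx (S' : Submodule ℤ V) : ℕ :=
  Nat.card (↥S' ⧸ Submodule.comap S'.subtype S)

/-- Three times a basis of `Ω` adapted to its discriminant group. -/
def coinvBasisInt : Matrix (Fin 12) (Fin 23) ℤ :=
  !![0, 3, 0, -3, 0, 0, 0, 0, 0, 0, 0, 0, 0, 0, 0, 0, 0, 0, 0, 0, 0, 0, 0;
     3, 3, 0, 0, -3, -3, 0, 0, 0, 0, 0, 0, 0, 0, 0, 0, 0, 0, 0, 0, 0, 0, 0;
     -2, -1, 2, 1, -1, 1, 1, -1, 0, 0, 0, 0, 0, 0, 0, 0, 1, -1, 0, 0, 0, 0, 0;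
     -1, -2, -1, 1, -1, 1, 3, 0, -2, -1, 2, 1, -2, -1, 2, 1, -2, -1, 0, 0, 0, 0, 0;
     0, 0, 0, 0, 0, 0, 0, 0, 0, 0, 0, 0, 0, 0, 0, 0, 0, 3, 0, 0, 0, 0, 0;
     0, 0, 0, 0, 0, 0, 0, 0, 0, 0, 0, 0, 0, 0, 0, 0, -3, 0, 0, 0, 0, 0, 0;
     0, 0, 0, 0, 0, 0, 0, 0, 3, 0, -3, 0, 0, 0, 0, 0, 0, 0, 0, 0, 0, 0, 0;
     0, 0, 0, 0, 0, 0, 0, 0, 0, 3, 0, -3, 0, 0, 0, 0, 0, 0, 0, 0, 0, 0, 0;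
     0, 0, 0, 0, 0, 0, 0, 0, 0, 0, 0, 0, 0, 3, 0, -3, 0, 0, 0, 0, 0, 0, 0;
     -1, 1, 1, -1, -1, 1, 1, -1, 0, 0, 0, 0, 1, 2, -1, -2, 0, 0, 0, 0, 0, 0, 0;
     -3, 0, 9, 0, -3, 0, -3, 0, 0, 0, 0, 0, 0, 0, 0, 0, 0, 0, 0, 0, 0, 0, 0;
     0, 3, 0, -9, 0, 3, 0, 3, 0, 0, 0, 0, 0, 0, 0, 0, 0, 0, 0, 0, 0, 0, 0]

/-- A `ℤ`-basis of `Ω` (as rows) adapted to its discriminant group. -/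
def coinvBasis : Matrix (Fin 12) (Fin 23) ℚ := Matrix.of fun i j => (coinvBasisInt i j : ℚ) / 3

/-- The Gram matrix of `coinvBasis`. -/
def coinvGram : Matrix (Fin 12) (Fin 12) ℤ :=
  !![-4, -1, 0, 2, 0, 0, 0, 0, 0, -2, -4, -8;
     -1, -4, 1, 1, 0, 0, 0, 0, 0, 0, 0, 0;
     0, 1, -4, -1, 2, 2, 0, 0, 0, -2, -4, 0;
     2, 1, -1, -8, 0, -2, 2, 0, 0, 0, 4, 4;
     0, 0, 2, 0, -4, -2, 0, 0, 0, 0, 0, 0;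
     0, 0, 2, -2, -2, -4, 0, 0, 0, 0, 0, 0;
     0, 0, 0, 2, 0, 0, -4, 2, 0, 0, 0, 0;
     0, 0, 0, 0, 0, 0, 2, -4, 0, 0, 0, 0;
     0, 0, 0, 0, 0, 0, 0, 0, -4, -2, 0, 0;
     -2, 0, -2, 0, 0, 0, 0, 0, -2, -4, -4, -4;
     -4, 0, -4, 4, 0, 0, 0, 0, 0, -4, -24, -12;
     -8, 0, 0, 4, 0, 0, 0, 0, 0, -4, -12, -24]

/-- The elementary divisors of `Ω`. -/
def coinvDiv : Fin 12 → ℤ := ![1, 1, 1, 1, 2, 2, 2, 2, 2, 2, 4, 4]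

/-- The matrix with `coinvGram * coinvDual = diagonal coinvDiv`. -/
def coinvDual : Matrix (Fin 12) (Fin 12) ℤ :=
  !![-6, -27, -165, 51, -76, -178, 68, 34, -102, 204, 124, -88;
     -27, -160, -966, 300, -444, -1044, 400, 200, -594, 1188, 728, -524;
     -165, -966, -5844, 1815, -2686, -6316, 2420, 1210, -3594, 7188, 4404, -3168;
     51, 300, 1815, -564, 834, 1962, -752, -376, 1116, -2232, -1368, 984;
     -38, -222, -1343, 417, -618, -1451, 556, 278, -826, 1652, 1012, -728;
     -89, -522, -3158, 981, -1451, -3414, 1308, 654, -1942, 3884, 2380, -1712;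
     34, 200, 1210, -376, 556, 1308, -502, -251, 744, -1488, -912, 656;
     17, 100, 605, -188, 278, 654, -251, -126, 372, -744, -456, 328;
     -51, -297, -1797, 558, -826, -1942, 744, 372, -1106, 2211, 1354, -974;
     102, 594, 3594, -1116, 1652, 3884, -1488, -744, 2211, -4422, -2708, 1948;
     31, 182, 1101, -342, 506, 1190, -456, -228, 677, -1354, -830, 597;
     -22, -131, -792, 246, -364, -856, 328, 164, -487, 974, 597, -430]

/-- The defining generators of `Ω`, in order. -/
def ΩGen : Fin 15 → V :=
  ![bv 16, bv 17,
   bv 10 - bv 8, bv 11 - bv 9, bv 14 - bv 12, bv 15 - bv 13,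
   bv 2 - bv 0, bv 0 - bv 4, bv 4 - bv 6, bv 1 - bv 3, bv 5 - bv 1, bv 7 - bv 5,
   (1/3 : ℚ) • (bv 0 - bv 2 - bv 4 + bv 6 - bv 1 + bv 3 + bv 5 - bv 7 + bv 16 - bv 17),
   (1/3 : ℚ) • (-(bv 0) + bv 6 + bv 1 - bv 7 - bv 8 + bv 10 + bv 9 - bv 11
      - bv 12 + bv 14 + bv 13 - bv 15),
   (1/3 : ℚ) • (bv 0 + bv 2 - bv 4 - bv 6 - bv 1 - bv 3 + bv 5 + bv 7
      - bv 8 + bv 10 + bv 9 - bv 11)]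

/-- Coordinates of the generators of `Ω` in `coinvBasis`. -/
def genCoords : Matrix (Fin 15) (Fin 12) ℤ :=
  !![0, 0, 0, 0, 0, -1, 0, 0, 0, 0, 0, 0;
     0, 0, 0, 0, 1, 0, 0, 0, 0, 0, 0, 0;
     0, 0, 0, 0, 0, 0, -1, 0, 0, 0, 0, 0;
     0, 0, 0, 0, 0, 0, 0, -1, 0, 0, 0, 0;
     0, -6, -36, 12, -8, -20, 8, 4, -10, 21, 7, -5;
     0, 0, 0, 0, 0, 0, 0, 0, -1, 0, 0, 0;
     2, 6, 39, -12, 9, 21, -8, -4, 12, -24, -7, 5;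
     -3, -7, -48, 15, -11, -26, 10, 5, -15, 30, 9, -6;
     0, -4, -21, 6, -5, -11, 4, 2, -6, 12, 4, -3;
     1, 0, 0, 0, 0, 0, 0, 0, 0, 0, 0, 0;
     -3, -8, -48, 15, -11, -26, 10, 5, -15, 30, 9, -6;
     3, 16, 96, -30, 22, 52, -20, -10, 30, -60, -18, 13;
     -2, -6, -38, 12, -9, -21, 8, 4, -12, 24, 7, -5;
     1, -1, -5, 2, -1, -3, 1, 1, -1, 3, 1, -1;
     -2, -4, -26, 8, -6, -14, 5, 3, -8, 16, 5, -3]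

/-- Coordinates of `coinvBasis` in the generators of `Ω`. -/
def basisCoords : Matrix (Fin 12) (Fin 15) ℤ :=
  !![0, 0, 0, 0, 0, 0, 0, 0, 0, 1, 0, 0, 0, 0, 0;
     0, 0, 0, 0, 0, 0, 0, 1, 0, 0, -1, 0, 0, 0, 0;
     0, 0, -1, 1, 0, 0, 0, -2, -1, -1, -2, -1, 1, 0, 3;
     -1, 0, 1, 0, 1, 0, 0, -1, -1, 0, 0, 0, 1, -1, 0;
     0, 1, 0, 0, 0, 0, 0, 0, 0, 0, 0, 0, 0, 0, 0;
     -1, 0, 0, 0, 0, 0, 0, 0, 0, 0, 0, 0, 0, 0, 0;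
     0, 0, -1, 0, 0, 0, 0, 0, 0, 0, 0, 0, 0, 0, 0;
     0, 0, 0, -1, 0, 0, 0, 0, 0, 0, 0, 0, 0, 0, 0;
     0, 0, 0, 0, 0, -1, 0, 0, 0, 0, 0, 0, 0, 0, 0;
     0, 0, -1, 1, -1, 0, 0, 0, 0, 0, 0, 0, 0, 2, 1;
     1, -1, -1, 1, 0, 0, 1, 0, -1, -2, -2, -2, -3, 0, 3;
     0, 0, 0, 0, 0, 0, 0, 0, 0, 3, 2, 1, 0, 0, 0]

lemma ΩGens_eq_range : ΩGens = Set.range ΩGen := by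
  simp only [ΩGens, ΩGen, Matrix.range_cons, Matrix.range_empty, Set.union_empty,
    Set.singleton_union]

lemma ΩGen_eq : ∀ i j, ΩGen i j = ∑ k, (genCoords i k : ℚ) * coinvBasis k j := by
  decide +kernel

lemma coinvBasis_eq (i : Fin 12) (j : Fin 23) :
    coinvBasis i j = ∑ k, (basisCoords i k : ℚ) * ΩGen k j := by
  have h : ∀ p : Fin 12 × Fin 23,
      coinvBasis p.1 p.2 = ∑ k, (basisCoords p.1 k : ℚ) * ΩGen k p.2 := by
    decide +kernel
  exact h (i, j)

lemma Ω_eq_span_range : Ω = Submodule.span ℤ (Set.range coinvBasis.row) := by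
  apply le_antisymm
  · rw [Ω, ΩGens_eq_range, Submodule.span_le]
    rintro _ ⟨i, rfl⟩
    refine (Submodule.mem_span_range_iff_exists_fun ℤ).2 ⟨genCoords i, ?_⟩
    ext j
    simp [ΩGen_eq i j]
  · rw [Ω, ΩGens_eq_range, Submodule.span_le]
    rintro _ ⟨i, rfl⟩
    refine (Submodule.mem_span_range_iff_exists_fun ℤ).2 ⟨basisCoords i, ?_⟩
    ext j
    simp [coinvBasis_eq i j]

/-- The coordinatewise inclusion `ℤ^12 ⊆ ℚ^12`. -/
def toRat (y : Fin 12 → ℤ) : Fin 12 → ℚ := fun i => (y i : ℚ)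

/-- The vector of `ℚΩ ⊕ ℚℓ` with coordinates `x` in `coinvBasis` and `ℓ`-coordinate `t`. -/
def spanVec (x : Fin 12 → ℚ) (t : ℚ) : V := x ᵥ* coinvBasis + t • ℓv

lemma spanVec_add (x y : Fin 12 → ℚ) (s t : ℚ) : spanVec x s + spanVec y t = spanVec (x + y) (s + t) := by
  simp only [spanVec, Matrix.add_vecMul, add_smul]
  abel

lemma zsmul_spanVec (k : ℤ) (x : Fin 12 → ℚ) (t : ℚ) :
    k • spanVec x t = spanVec ((k : ℚ) • x) ((k : ℚ) * t) := by
  rw [← Int.cast_smul_eq_zsmul ℚ]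
  simp only [spanVec, Matrix.smul_vecMul, smul_add, smul_smul]

lemma ℓv_eq_spanVec : ℓv = spanVec 0 1 := by simp [spanVec]

lemma spanVec_last (x : Fin 12 → ℚ) (t : ℚ) : spanVec x t 22 = t := by
  have h : ∀ i, coinvBasis i 22 = 0 := by decide +kernel
  have h' : ℓv 22 = 1 := by simp [ℓv, bv]
  simp [spanVec, Matrix.vecMul, dotProduct, h, h']

lemma mem_Ω_iff {v : V} : v ∈ Ω ↔ ∃ y : Fin 12 → ℤ, v = spanVec (toRat y) 0 := by
  rw [Ω_eq_span_range, Submodule.mem_span_range_iff_exists_fun]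
  refine exists_congr fun y => ?_
  rw [eq_comm]
  have : spanVec (toRat y) 0 = ∑ i, y i • coinvBasis.row i := by
    ext j
    simp [spanVec, toRat, Matrix.vecMul, dotProduct]
  rw [this]

lemma spanVec_toRat_mem_Ω (y : Fin 12 → ℤ) : spanVec (toRat y) 0 ∈ Ω := mem_Ω_iff.2 ⟨y, rfl⟩

lemma mem_ratSpan_Ω_iff {v : V} :
    v ∈ Submodule.span ℚ (Ω : Set V) ↔ ∃ x : Fin 12 → ℚ, v = spanVec x 0 := by
  constructor
  · intro hv
    have hle : Submodule.span ℚ (Ω : Set V) ≤ LinearMap.range coinvBasis.vecMulLinear := by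
      rw [Submodule.span_le]
      intro u hu
      obtain ⟨y, rfl⟩ := mem_Ω_iff.1 hu
      exact ⟨toRat y, by simp [spanVec]⟩
    obtain ⟨x, rfl⟩ := hle hv
    exact ⟨x, by simp [spanVec]⟩
  · rintro ⟨x, rfl⟩
    have : spanVec x 0 = ∑ i, x i • coinvBasis.row i := by
      ext j
      simp [spanVec, Matrix.vecMul, dotProduct]
    rw [this]
    refine Submodule.sum_mem _ fun i _ => Submodule.smul_mem _ _ (Submodule.subset_span ?_)
    rw [Ω_eq_span_range]
    exact Submodule.subset_span ⟨i, rfl⟩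

lemma ℓv_mem_S : ℓv ∈ S := Submodule.mem_sup_right (Submodule.mem_span_singleton_self _)

lemma mem_ratSpan_S_iff {v : V} :
    v ∈ Submodule.span ℚ (S : Set V) ↔ ∃ x t, v = spanVec x t := by
  constructor
  · intro hv
    have hle : Submodule.span ℚ (S : Set V) ≤
        Submodule.span ℚ (Ω : Set V) ⊔ Submodule.span ℚ {ℓv} := by
      rw [Submodule.span_le]
      intro u hu
      obtain ⟨a, ha, b, hb, rfl⟩ := Submodule.mem_sup.1 hu
      obtain ⟨k, rfl⟩ := Submodule.mem_span_singleton.1 hb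
      refine Submodule.add_mem_sup (Submodule.subset_span ha) ?_
      rw [← Int.cast_smul_eq_zsmul ℚ]
      exact Submodule.smul_mem _ _ (Submodule.mem_span_singleton_self _)
    obtain ⟨a, ha, b, hb, rfl⟩ := Submodule.mem_sup.1 (hle hv)
    obtain ⟨x, rfl⟩ := mem_ratSpan_Ω_iff.1 ha
    obtain ⟨t, rfl⟩ := Submodule.mem_span_singleton.1 hb
    exact ⟨x, t, by simp [spanVec]⟩
  · rintro ⟨x, t, rfl⟩
    have h : spanVec x t = spanVec x 0 + t • ℓv := by simp [spanVec]
    rw [h]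
    refine Submodule.add_mem _ ?_
      (Submodule.smul_mem _ _ (Submodule.subset_span ℓv_mem_S))
    exact Submodule.span_mono (SetLike.coe_subset_coe.2 le_sup_left)
      (mem_ratSpan_Ω_iff.2 ⟨x, rfl⟩)

/-- The bilinear form of `Ω` in the basis `coinvBasis`. -/
def coinvForm (x y : Fin 12 → ℚ) : ℚ := x ⬝ᵥ (coinvGram.map (Int.cast : ℤ → ℚ) *ᵥ y)

lemma coinvBasis_mul_gramX :
    coinvBasis * gramX 0 * coinvBasisᵀ = coinvGram.map (Int.cast : ℤ → ℚ) := by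
  have h : ∀ i j, (coinvBasis * gramX 0 * coinvBasisᵀ) i j = (coinvGram i j : ℚ) := by
    decide +kernel
  ext i j
  exact h i j

lemma B_eq_B_zero (d : ℤ) (u v : V) : B d u v = B 0 u v + 2 * d * (u 22 * v 22) := by
  have h : gramX d = gramX 0 + Matrix.single 22 22 (2 * (d : ℚ)) := by
    ext i j
    simp only [gramX, Matrix.of_apply, Matrix.add_apply, Matrix.single_apply, Fin.ext_iff]
    have h22 : ((22 : Fin 23) : ℕ) = 22 := rfl
    rw [h22]
    split_ifs <;> first | omega | simp
  rw [B, h, Matrix.add_mulVec, dotProduct_add, B]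
  congr 1
  simp [Matrix.single_mulVec, dotProduct, Function.update_apply]
  ring

lemma B_spanVec (d : ℤ) (x y : Fin 12 → ℚ) (s t : ℚ) :
    B d (spanVec x s) (spanVec y t) = coinvForm x y + 2 * d * (s * t) := by
  rw [B_eq_B_zero, spanVec_last, spanVec_last]
  congr 1
  have h₁ : gramX 0 *ᵥ ℓv = 0 := by
    have : ∀ i, (gramX 0 *ᵥ ℓv) i = 0 := by decide +kernel
    exact funext this
  have h₂ : ℓv ᵥ* gramX 0 = 0 := by
    have : ∀ i, (ℓv ᵥ* gramX 0) i = 0 := by decide +kernel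
    exact funext this
  rw [B, spanVec, spanVec, Matrix.mulVec_add, Matrix.mulVec_smul, h₁, smul_zero, add_zero,
    Matrix.dotProduct_mulVec, Matrix.add_vecMul, Matrix.smul_vecMul, h₂, smul_zero, add_zero,
    coinvForm, ← coinvBasis_mul_gramX, Matrix.vecMul_vecMul, ← Matrix.mulVec_mulVec,
    Matrix.dotProduct_mulVec x, Matrix.mulVec_transpose]

lemma coinvForm_comm (x y : Fin 12 → ℚ) : coinvForm x y = coinvForm y x := by
  have h : (coinvGram.map (Int.cast : ℤ → ℚ))ᵀ = coinvGram.map (Int.cast : ℤ → ℚ) := by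
    have : coinvGramᵀ = coinvGram := by decide +kernel
    rw [← Matrix.transpose_map, this]
  rw [coinvForm, Matrix.dotProduct_mulVec, dotProduct_comm, ← Matrix.mulVec_transpose, h,
    coinvForm]

lemma coinvForm_add_left (x y z : Fin 12 → ℚ) :
    coinvForm (x + y) z = coinvForm x z + coinvForm y z := add_dotProduct _ _ _

lemma coinvForm_smul_left (a : ℚ) (x y : Fin 12 → ℚ) :
    coinvForm (a • x) y = a * coinvForm x y := smul_dotProduct _ _ _

lemma coinvForm_add_right (x y z : Fin 12 → ℚ) :
    coinvForm x (y + z) = coinvForm x y + coinvForm x z := by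
  rw [coinvForm_comm, coinvForm_add_left, coinvForm_comm y, coinvForm_comm z]

lemma coinvForm_smul_right (a : ℚ) (x y : Fin 12 → ℚ) :
    coinvForm x (a • y) = a * coinvForm x y := by
  rw [coinvForm_comm, coinvForm_smul_left, coinvForm_comm y]

/-- A rational vector pairing integrally with `Ω` lies in the span of the dual basis. -/
lemma coinvDiv_mul_eq {x : Fin 12 → ℚ} {w : Fin 12 → ℤ}
    (h : x ᵥ* coinvGram.map (Int.cast : ℤ → ℚ) = toRat w) (i : Fin 12) :
    x i * coinvDiv i = ((w ᵥ* coinvDual) i : ℤ) := by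
  have hK : coinvGram * coinvDual = Matrix.diagonal coinvDiv := by decide +kernel
  have hKQ : coinvGram.map (Int.cast : ℤ → ℚ) * coinvDual.map (Int.cast : ℤ → ℚ) =
      Matrix.diagonal fun i => (coinvDiv i : ℚ) := by
    have := congrArg (Int.castRingHom ℚ).mapMatrix hK
    rw [map_mul] at this
    refine this.trans ?_
    simp [Matrix.diagonal_map]
  have h' := congrArg (fun z => (z ᵥ* coinvDual.map (Int.cast : ℤ → ℚ)) i) h
  simp only [Matrix.vecMul_vecMul, hKQ, Matrix.vecMul_diagonal] at h'
  rw [h']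
  simp [Matrix.vecMul, dotProduct, toRat]

lemma vecMul_coinvGram_apply (x : Fin 12 → ℚ) (j : Fin 12) :
    (x ᵥ* coinvGram.map (Int.cast : ℤ → ℚ)) j = coinvForm x (toRat (Pi.single j 1)) := by
  have h : toRat (Pi.single j 1) = Pi.single j (1 : ℚ) := by
    ext i
    by_cases hij : i = j
    · subst hij; simp [toRat]
    · simp [toRat, hij]
  rw [coinvForm, Matrix.dotProduct_mulVec, h, dotProduct_single_one]

lemma spanVec_zero_injective {x : Fin 12 → ℚ} (h : spanVec x 0 = 0) : x = 0 := by
  have hw : x ᵥ* coinvGram.map (Int.cast : ℤ → ℚ) = toRat 0 := by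
    ext j
    have := B_spanVec 0 x (toRat (Pi.single j 1)) 0 0
    rw [h] at this
    rw [vecMul_coinvGram_apply]
    simpa [B, toRat] using this.symm
  ext i
  have := coinvDiv_mul_eq hw i
  have hpos : ∀ i, coinvDiv i ≠ 0 := by decide
  simpa [hpos i] using this

/-- Half of the quadratic form of `Ω`. -/
lemma coinvForm_self (x : Fin 12 → ℚ) : coinvForm x x = 2 *
    (-2 * x 0 ^ 2 - x 0 * x 1 + 2 * x 0 * x 3 - 2 * x 0 * x 9 - 4 * x 0 * x 10 - 8 * x 0 * x 11
    - 2 * x 1 ^ 2 + x 1 * x 2 + x 1 * x 3 - 2 * x 2 ^ 2 - x 2 * x 3 + 2 * x 2 * x 4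
    + 2 * x 2 * x 5 - 2 * x 2 * x 9 - 4 * x 2 * x 10 - 4 * x 3 ^ 2 - 2 * x 3 * x 5 + 2 * x 3 * x 6
    + 4 * x 3 * x 10 + 4 * x 3 * x 11 - 2 * x 4 ^ 2 - 2 * x 4 * x 5 - 2 * x 5 ^ 2 - 2 * x 6 ^ 2
    + 2 * x 6 * x 7 - 2 * x 7 ^ 2 - 2 * x 8 ^ 2 - 2 * x 8 * x 9 - 2 * x 9 ^ 2 - 4 * x 9 * x 10
    - 4 * x 9 * x 11 - 12 * x 10 ^ 2 - 12 * x 10 * x 11 - 12 * x 11 ^ 2) := by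
  simp [coinvForm, coinvGram, Matrix.mulVec, dotProduct, Fin.sum_univ_succ]
  ring

/-- The element of the dual of `Ω` with coordinates `m` in the basis
`coinvBasis i / coinvDiv i`. -/
def dualVec (m : Fin 12 → ℤ) : Fin 12 → ℚ := fun i => m i / coinvDiv i

lemma exists_coinvForm_dualVec (m : Fin 12 → ℤ) : ∃ r : ℤ,
    coinvForm (dualVec m) (dualVec m) =
      r - 3 / 2 * ((m 10 ^ 2 + m 10 * m 11 + m 11 ^ 2 : ℤ) : ℚ) := by
  refine ⟨-4 * m 0 ^ 2 - 2 * m 0 * m 1 + 4 * m 0 * m 3 - 2 * m 0 * m 9 - 2 * m 0 * m 10 - 4 * m 0 * m 11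
    - 4 * m 1 ^ 2 + 2 * m 1 * m 2 + 2 * m 1 * m 3 - 4 * m 2 ^ 2 - 2 * m 2 * m 3 + 2 * m 2 * m 4
    + 2 * m 2 * m 5 - 2 * m 2 * m 9 - 2 * m 2 * m 10 - 8 * m 3 ^ 2 - 2 * m 3 * m 5 + 2 * m 3 * m 6
    + 2 * m 3 * m 10 + 2 * m 3 * m 11 - m 4 ^ 2 - m 4 * m 5 - m 5 ^ 2 - m 6 ^ 2
    + m 6 * m 7 - m 7 ^ 2 - m 8 ^ 2 - m 8 * m 9 - m 9 ^ 2 - m 9 * m 10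
    - m 9 * m 11, ?_⟩
  rw [coinvForm_self]
  simp only [dualVec, coinvDiv]
  simp
  ring

lemma coinvForm_toRat (y z : Fin 12 → ℤ) :
    coinvForm (toRat y) (toRat z) = (y ⬝ᵥ (coinvGram *ᵥ z) : ℤ) := by
  simp [coinvForm, Matrix.mulVec, dotProduct, toRat]

lemma exists_coinvForm_toRat_self (y : Fin 12 → ℤ) :
    ∃ r : ℤ, coinvForm (toRat y) (toRat y) = 2 * r := by
  rw [coinvForm_self]
  generalize hx : toRat y = x
  have h : ∀ i, x i = y i := fun i => by rw [← hx]; rfl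
  simp only [h]
  norm_cast
  exact ⟨_, rfl⟩

lemma exists_last_of_mem_S {u : V} (hu : u ∈ S) : ∃ k : ℤ, u 22 = k := by
  obtain ⟨a, ha, b, hb, rfl⟩ := Submodule.mem_sup.1 hu
  obtain ⟨y, rfl⟩ := mem_Ω_iff.1 ha
  obtain ⟨k, rfl⟩ := Submodule.mem_span_singleton.1 hb
  refine ⟨k, ?_⟩
  rw [ℓv_eq_spanVec, zsmul_spanVec, spanVec_add, spanVec_last]
  simp

namespace IsAdmissible

variable {d : ℤ} {S' : Submodule ℤ V}

lemma mem_S (h : IsAdmissible d S') {u : V} (hu : u ∈ S') {k : ℤ} (hk : u 22 = k) : u ∈ S := by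
  have hmem : u - k • ℓv ∈ S' :=
    sub_mem hu (Submodule.smul_mem _ _ (h.1 ℓv_mem_S))
  obtain ⟨x, t, rfl⟩ := mem_ratSpan_S_iff.1 (h.2.1 hu)
  rw [spanVec_last] at hk
  subst hk
  have heq : spanVec x k - k • ℓv = spanVec x 0 := by
    rw [sub_eq_iff_eq_add, ℓv_eq_spanVec, zsmul_spanVec, spanVec_add]
    simp
  rw [heq] at hmem
  have hΩ : spanVec x 0 ∈ Ω := by
    rw [← h.2.2.2.2.1]
    exact ⟨hmem, mem_ratSpan_Ω_iff.2 ⟨x, rfl⟩⟩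
  rw [sub_eq_iff_eq_add.1 heq]
  exact Submodule.add_mem_sup hΩ
    (Submodule.smul_mem _ _ (Submodule.mem_span_singleton_self _))

lemma mul_last_int (h : IsAdmissible d S') {x : Fin 12 → ℚ} {t : ℚ} (hu : spanVec x t ∈ S')
    {k : ℤ} {y : Fin 12 → ℤ} (hy : (k : ℚ) • x = toRat y) : ∃ j : ℤ, k * t = j := by
  have hΩ : spanVec (toRat y) 0 ∈ S' := h.1 (Submodule.mem_sup_left (spanVec_toRat_mem_Ω y))
  have hmem := sub_mem (Submodule.smul_mem _ k hu) hΩ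
  have heq : k • spanVec x t - spanVec (toRat y) 0 = (k * t) • ℓv := by
    rw [sub_eq_iff_eq_add, zsmul_spanVec, hy]
    simp [spanVec, add_comm]
  rw [heq] at hmem
  have hℓ : ((k : ℚ) * t) • ℓv ∈ Submodule.span ℤ {ℓv} := by
    rw [← h.2.2.2.2.2]
    exact ⟨hmem, Submodule.smul_mem _ _ (Submodule.mem_span_singleton_self _)⟩
  obtain ⟨j, hj⟩ := Submodule.mem_span_singleton.1 hℓ
  refine ⟨j, ?_⟩
  have := congrFun hj 22
  simpa [ℓv, bv] using this.symm

lemma exists_dualVec (h : IsAdmissible d S') {u : V} (hu : u ∈ S') :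
    ∃ m : Fin 12 → ℤ, u = spanVec (dualVec m) (u 22) := by
  obtain ⟨x, t, rfl⟩ := mem_ratSpan_S_iff.1 (h.2.1 hu)
  have hint : ∀ j, ∃ w : ℤ, (x ᵥ* coinvGram.map (Int.cast : ℤ → ℚ)) j = w := fun j => by
    obtain ⟨w, hw⟩ := h.2.2.1 _ hu _
      (h.1 (Submodule.mem_sup_left (spanVec_toRat_mem_Ω (Pi.single j 1))))
    refine ⟨w, ?_⟩
    rw [B_spanVec] at hw
    rw [vecMul_coinvGram_apply, ← hw]
    ring
  choose w hw using hint
  refine ⟨w ᵥ* coinvDual, ?_⟩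
  rw [spanVec_last]
  congr 1
  ext i
  have hpos : ∀ i, coinvDiv i ≠ 0 := by decide
  rw [dualVec, eq_div_iff (Int.cast_ne_zero.2 (hpos i)), coinvDiv_mul_eq (funext hw) i]

lemma four_mul_last_int (h : IsAdmissible d S') {u : V} (hu : u ∈ S') :
    ∃ k : ℤ, 4 * u 22 = k := by
  obtain ⟨m, hm⟩ := h.exists_dualVec hu
  rw [hm] at hu
  refine h.mul_last_int hu (k := 4) (y := fun i => 4 / coinvDiv i * m i) ?_
  ext i
  have hdiv : ∀ i, 4 / coinvDiv i * coinvDiv i = 4 := by decide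
  have hpos : ∀ i, coinvDiv i ≠ 0 := by decide
  have hi : (coinvDiv i : ℚ) ≠ 0 := Int.cast_ne_zero.2 (hpos i)
  have hc : (((4 / coinvDiv i : ℤ)) : ℚ) * coinvDiv i = 4 := by exact_mod_cast hdiv i
  simp only [toRat, dualVec, Pi.smul_apply, smul_eq_mul, Int.cast_mul]
  rw [← mul_div_assoc, div_eq_iff hi]
  push_cast
  linear_combination (-(m i : ℚ)) * hc

/-- The index of an admissible overlattice is the common denominator of the
`ℓ`-coordinates of its elements. -/
lemma idx_eq (h : IsAdmissible d S') {n : ℕ} (hn : 0 < n)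
    (hint : ∀ u ∈ S', ∃ k : ℤ, n * u 22 = k) {g : V} (hg : g ∈ S') (hg' : g 22 = 1 / n) :
    idx S' = n := by
  have hn' : (n : ℚ) ≠ 0 := by exact_mod_cast hn.ne'
  let f : ℤ →ₗ[ℤ] (↥S' ⧸ Submodule.comap S'.subtype S) :=
    LinearMap.toSpanSingleton ℤ _ (Submodule.Quotient.mk ⟨g, hg⟩)
  have hf : ∀ k : ℤ, f k = Submodule.Quotient.mk (k • ⟨g, hg⟩) := fun k => rfl
  have hker : LinearMap.ker f = Ideal.span {(n : ℤ)} := by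
    ext k
    rw [LinearMap.mem_ker, hf, Submodule.Quotient.mk_eq_zero, Submodule.mem_comap,
      Ideal.mem_span_singleton]
    have hlast : (k • g) 22 = k / n := by simp [hg', div_eq_mul_inv]
    constructor
    · intro hk
      obtain ⟨j, hj⟩ := exists_last_of_mem_S hk
      refine ⟨j, ?_⟩
      have : (k : ℚ) / n = j := by rw [← hlast]; exact hj
      rw [div_eq_iff hn'] at this
      have h' : (k : ℚ) = ((n * j : ℤ) : ℚ) := by push_cast; linarith
      exact_mod_cast h'
    · rintro ⟨j, rfl⟩
      refine h.mem_S (Submodule.smul_mem _ _ hg) (k := j) ?_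
      refine hlast.trans ?_
      push_cast
      field_simp
  have hsurj : Function.Surjective f := by
    intro q
    obtain ⟨⟨u, hu⟩, rfl⟩ := Submodule.Quotient.mk_surjective _ q
    obtain ⟨k, hk⟩ := hint u hu
    refine ⟨k, ?_⟩
    rw [hf, Submodule.Quotient.eq]
    refine h.mem_S (k := 0) (sub_mem (Submodule.smul_mem _ _ hg) hu) ?_
    have : u 22 = k / n := by rw [eq_div_iff hn', mul_comm, hk]
    simp [hg', this, div_eq_mul_inv]
  have e := f.quotKerEquivOfSurjective hsurj
  rw [idx, ← Nat.card_congr e.toEquiv, hker,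
    Nat.card_congr (Int.quotientSpanNatEquivZMod n).toEquiv, Nat.card_zmod]

lemma idx_cases (h : IsAdmissible d S') :
    idx S' = 1 ∨ (idx S' = 2 ∧ ∃ g ∈ S', g 22 = 1 / 2) ∨ (idx S' = 4 ∧ ∃ g ∈ S', g 22 = 1 / 4) := by
  have hℓ : ℓv ∈ S' := h.1 ℓv_mem_S
  have hℓ' : ℓv 22 = 1 := by simp [ℓv, bv]
  by_cases h₄ : ∃ u ∈ S', ∃ k : ℤ, 4 * u 22 = 2 * k + 1
  · obtain ⟨u, hu, k, hk⟩ := h₄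
    obtain ⟨q, r, hr, hkq⟩ : ∃ q r : ℤ, (r = 1 ∨ r = -1) ∧ 2 * k + 1 = 4 * q + r := by
      rcases Int.even_or_odd' k with ⟨q, rfl | rfl⟩
      · exact ⟨q, 1, Or.inl rfl, by ring⟩
      · exact ⟨q + 1, -1, Or.inr rfl, by ring⟩
    have hg : r • (u - q • ℓv) ∈ S' :=
      Submodule.smul_mem _ _ (sub_mem hu (Submodule.smul_mem _ _ hℓ))
    have hg' : (r • (u - q • ℓv)) 22 = 1 / 4 := by
      have hkq' : 2 * (k : ℚ) + 1 = 4 * q + r := by exact_mod_cast hkq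
      have hu' : u 22 = q + r / 4 := by linarith
      rcases hr with rfl | rfl <;> (simp [hℓ', hu']; try norm_num)
    exact Or.inr (Or.inr ⟨h.idx_eq (by norm_num) (fun v hv => by
      simpa using h.four_mul_last_int hv) hg (by simpa using hg'), _, hg, hg'⟩)
  have htwo : ∀ u ∈ S', ∃ k : ℤ, 2 * u 22 = k := by
    intro u hu
    obtain ⟨k, hk⟩ := h.four_mul_last_int hu
    rcases Int.even_or_odd' k with ⟨q, rfl | rfl⟩
    · exact ⟨q, by push_cast at hk; linarith⟩
    · exact absurd ⟨u, hu, q, by rw [hk]; push_cast; ring⟩ h₄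
  by_cases h₂ : ∃ u ∈ S', ∃ k : ℤ, 2 * u 22 = 2 * k + 1
  · obtain ⟨u, hu, k, hk⟩ := h₂
    have hg : u - k • ℓv ∈ S' := sub_mem hu (Submodule.smul_mem _ _ hℓ)
    have hg' : (u - k • ℓv) 22 = 1 / 2 := by
      have hu' : u 22 = k + 1 / 2 := by linarith
      simp [hℓ', hu']
    exact Or.inr (Or.inl ⟨h.idx_eq (by norm_num) (fun v hv => by
      simpa using htwo v hv) hg (by simpa using hg'), _, hg, hg'⟩)
  refine Or.inl (h.idx_eq one_pos (fun u hu => ?_) hℓ (by simp [hℓ']))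
  obtain ⟨k, hk⟩ := htwo u hu
  rcases Int.even_or_odd' k with ⟨q, rfl | rfl⟩
  · exact ⟨q, by push_cast at hk ⊢; linarith⟩
  · exact absurd ⟨u, hu, q, by rw [hk]; push_cast; ring⟩ h₂

lemma two_dvd (h : IsAdmissible d S') {g : V} (hg : g ∈ S') (hg' : g 22 = 1 / 2) : 2 ∣ d := by
  obtain ⟨m, hm⟩ := h.exists_dualVec hg
  rw [hg'] at hm
  subst hm
  have hΩ : spanVec ((2 : ℤ) • dualVec m) 0 ∈ Ω := by
    rw [← h.2.2.2.2.1]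
    refine ⟨?_, mem_ratSpan_Ω_iff.2 ⟨_, rfl⟩⟩
    have heq : spanVec ((2 : ℤ) • dualVec m) 0 = (2 : ℤ) • spanVec (dualVec m) (1 / 2) - ℓv := by
      rw [eq_sub_iff_add_eq, ℓv_eq_spanVec, zsmul_spanVec, spanVec_add, Int.cast_smul_eq_zsmul]
      simp
    rw [heq]
    exact sub_mem (Submodule.smul_mem _ _ hg) (h.1 ℓv_mem_S)
  obtain ⟨y, hy⟩ := mem_Ω_iff.1 hΩ
  have hy' : (2 : ℤ) • dualVec m = toRat y := by
    refine sub_eq_zero.1 (spanVec_zero_injective ?_)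
    have h0 := sub_eq_zero.2 hy
    simpa [spanVec, Matrix.sub_vecMul] using h0
  have h10 : m 10 = 2 * y 10 := by
    have := congrFun hy' 10
    simp [dualVec, coinvDiv, toRat] at this
    have h' : (m 10 : ℚ) = 2 * y 10 := by linarith
    exact_mod_cast h'
  have h11 : m 11 = 2 * y 11 := by
    have := congrFun hy' 11
    simp [dualVec, coinvDiv, toRat] at this
    have h' : (m 11 : ℚ) = 2 * y 11 := by linarith
    exact_mod_cast h'
  obtain ⟨r, hr⟩ := exists_coinvForm_dualVec m
  obtain ⟨n, hn⟩ := h.2.2.2.1 _ hg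
  rw [B_spanVec, hr, h10, h11] at hn
  refine ⟨2 * n - r + 6 * (y 10 ^ 2 + y 10 * y 11 + y 11 ^ 2), ?_⟩
  qify
  push_cast at hn
  linarith

lemma mod_sixteen (h : IsAdmissible d S') {g : V} (hg : g ∈ S') (hg' : g 22 = 1 / 4) :
    d % 16 = 4 ∨ d % 16 = 12 := by
  obtain ⟨m, hm⟩ := h.exists_dualVec hg
  rw [hg'] at hm
  subst hm
  have hodd : Odd (m 10 ^ 2 + m 10 * m 11 + m 11 ^ 2) := by
    by_contra hcon
    have heven : Even (m 10) ∧ Even (m 11) := by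
      rw [Int.not_odd_iff_even] at hcon
      by_cases h₁ : Even (m 10) <;> by_cases h₂ : Even (m 11) <;>
        simp [h₁, h₂, Int.even_add, Int.even_pow, Int.even_mul] at hcon ⊢
    obtain ⟨⟨a, ha⟩, b, hb⟩ := heven
    obtain ⟨j, hj⟩ := h.mul_last_int hg (k := 2)
      (y := ![2 * m 0, 2 * m 1, 2 * m 2, 2 * m 3, m 4, m 5, m 6, m 7, m 8, m 9, a, b]) (by
        ext i
        fin_cases i <;> simp [dualVec, coinvDiv, toRat, ha, hb] <;> ring)
    have h2 : 2 * j = 1 := by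
      qify
      rw [← hj]
      norm_num
    omega
  obtain ⟨k, hk⟩ := hodd
  obtain ⟨r, hr⟩ := exists_coinvForm_dualVec m
  obtain ⟨n, hn⟩ := h.2.2.2.1 _ hg
  rw [B_spanVec, hr, hk] at hn
  have hd : d = 16 * n - 8 * r + 24 * k + 12 := by
    qify
    push_cast at hn
    linarith
  omega

end IsAdmissible

/-- The gluing of `Ω` and `ℤℓ` along the vector `y / n` of the dual of `Ω`. -/
lemma exists_isAdmissible_idx {d : ℤ} {n : ℕ} (hn : 0 < n) (y w : Fin 12 → ℤ)
    (hw : y ᵥ* coinvGram = (n : ℤ) • w) {i : Fin 12} (hi : y i = 1) {s c : ℤ}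
    (hs : y ⬝ᵥ (coinvGram *ᵥ y) = s) (hc : s + 2 * d = 2 * c * n ^ 2) :
    ∃ S' : Submodule ℤ V, IsAdmissible d S' ∧ idx S' = n := by
  have hn' : (n : ℚ) ≠ 0 := by exact_mod_cast hn.ne'
  have hcQ : (s : ℚ) + 2 * d = 2 * c * n ^ 2 := by exact_mod_cast hc
  set x : Fin 12 → ℚ := (1 / n : ℚ) • toRat y with hx
  have hxz (z : Fin 12 → ℤ) : coinvForm x (toRat z) = (w ⬝ᵥ z : ℤ) := by
    rw [hx, coinvForm_smul_left, coinvForm_toRat, Matrix.dotProduct_mulVec, hw, smul_dotProduct,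
      smul_eq_mul]
    push_cast
    field_simp
  have hxx : coinvForm x x + 2 * d * (1 / n * (1 / n)) = 2 * c := by
    rw [hx, coinvForm_smul_left, coinvForm_smul_right, coinvForm_toRat, hs]
    field_simp
    linarith
  set g : V := spanVec x (1 / n) with hg
  set S' : Submodule ℤ V := Ω ⊔ Submodule.span ℤ {g}
  have hmem (u : V) (hu : u ∈ S') : ∃ (z : Fin 12 → ℤ) (k : ℤ),
      u = spanVec (toRat z + (k : ℚ) • x) (k * (1 / n)) := by
    obtain ⟨a, ha, b, hb, rfl⟩ := Submodule.mem_sup.1 hu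
    obtain ⟨z, rfl⟩ := mem_Ω_iff.1 ha
    obtain ⟨k, rfl⟩ := Submodule.mem_span_singleton.1 hb
    exact ⟨z, k, by rw [hg, zsmul_spanVec, spanVec_add, zero_add]⟩
  have hgS : g ∈ S' := Submodule.mem_sup_right (Submodule.mem_span_singleton_self _)
  have hΩS : Ω ≤ S' := le_sup_left
  have hℓS : ℓv ∈ S' := by
    have heq : ℓv = (n : ℤ) • g - spanVec (toRat y) 0 := by
      rw [eq_sub_iff_add_eq, hg, zsmul_spanVec, ℓv_eq_spanVec, spanVec_add, hx, smul_smul]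
      simp [hn']
    rw [heq]
    exact sub_mem (Submodule.smul_mem _ _ hgS) (hΩS (spanVec_toRat_mem_Ω y))
  clear_value x
  have hB (z z' : Fin 12 → ℤ) (k k' : ℤ) :
      B d (spanVec (toRat z + (k : ℚ) • x) (k * (1 / n)))
        (spanVec (toRat z' + (k' : ℚ) • x) (k' * (1 / n))) =
      coinvForm (toRat z) (toRat z') + k' * (w ⬝ᵥ z : ℤ) + k * (w ⬝ᵥ z' : ℤ) +
        2 * (k * k' * c) := by
    rw [B_spanVec, coinvForm_add_left, coinvForm_add_right, coinvForm_add_right,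
      coinvForm_smul_left, coinvForm_smul_left, coinvForm_smul_right, coinvForm_smul_right,
      coinvForm_comm (toRat z) x, hxz, hxz]
    linear_combination ((k : ℚ) * k') * hxx
  have hadm : IsAdmissible d S' := by
    refine ⟨sup_le hΩS (by simpa using hℓS), fun u hu => ?_, fun u hu v hv => ?_, fun u hu => ?_,
      le_antisymm ?_ ?_, le_antisymm ?_ ?_⟩
    · obtain ⟨z, k, rfl⟩ := hmem u hu
      exact mem_ratSpan_S_iff.2 ⟨_, _, rfl⟩
    · obtain ⟨z, k, rfl⟩ := hmem u hu
      obtain ⟨z', k', rfl⟩ := hmem v hv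
      rw [hB, coinvForm_toRat]
      norm_cast
      exact ⟨_, rfl⟩
    · obtain ⟨z, k, rfl⟩ := hmem u hu
      obtain ⟨r, hr⟩ := exists_coinvForm_toRat_self z
      refine ⟨r + k * (w ⬝ᵥ z) + k * k * c, ?_⟩
      rw [hB, hr]
      push_cast
      ring
    · rintro u ⟨hu, hu'⟩
      obtain ⟨z, k, rfl⟩ := hmem u hu
      obtain ⟨x', hx'⟩ := mem_ratSpan_Ω_iff.1 hu'
      have hlast := congrFun hx' 22
      rw [spanVec_last, spanVec_last] at hlast
      have hk : (k : ℚ) = 0 := by simpa [hn'] using hlast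
      simpa [hk] using spanVec_toRat_mem_Ω z
    · exact le_inf hΩS fun u hu => Submodule.subset_span hu
    · rintro u ⟨hu, hu'⟩
      obtain ⟨z, k, rfl⟩ := hmem u hu
      obtain ⟨t, ht⟩ := Submodule.mem_span_singleton.1 hu'
      have ht' : spanVec (toRat z + (k : ℚ) • x) 0 = (t - k * (1 / n)) • ℓv := by
        rw [sub_smul, ht]
        simp [spanVec]
      have htk : 0 = t - k * (1 / n) := by
        simpa [spanVec_last, ℓv, bv] using congrFun ht' 22
      rw [← htk, zero_smul] at ht'
      have hzi := congrFun (spanVec_zero_injective ht') i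
      have hkn : (k : ℚ) * (1 / n) = -z i := by
        simp only [hx, toRat, Pi.add_apply, Pi.smul_apply, smul_eq_mul, hi, Pi.zero_apply,
          Int.cast_one, mul_one] at hzi
        linarith
      refine Submodule.mem_span_singleton.2 ⟨-z i, ?_⟩
      rw [← ht, ← Int.cast_smul_eq_zsmul ℚ]
      congr 1
      push_cast
      linarith
    · rw [Submodule.span_singleton_le_iff_mem]
      exact ⟨hℓS, Submodule.mem_span_singleton_self _⟩
  refine ⟨S', hadm, hadm.idx_eq hn (fun u hu => ?_) hgS (spanVec_last _ _)⟩
  obtain ⟨z, k, rfl⟩ := hmem u hu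
  refine ⟨k, ?_⟩
  rw [spanVec_last]
  field_simp

/-- any admissible even overlattice S' of S = Ω_{2,2} ⊕ ⟨2d⟩ has
index 1, 2 or 4 over S; index 2 is realized iff d is even, and index 4 is
realized iff d ≡ 4 or 12 (mod 16). -/
theorem stmt13 (d : ℤ) (hd : 0 < d) :
    (∀ S' : Submodule ℤ V, IsAdmissible d S' →
      idx S' = 1 ∨ idx S' = 2 ∨ idx S' = 4) ∧
    ((∃ S' : Submodule ℤ V, IsAdmissible d S' ∧ idx S' = 2) ↔ 2 ∣ d) ∧
    ((∃ S' : Submodule ℤ V, IsAdmissible d S' ∧ idx S' = 4) ↔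
      (d % 16 = 4 ∨ d % 16 = 12)) := by
  refine ⟨fun S' h => ?_, ⟨?_, fun hd2 => ?_⟩, ⟨?_, fun hd4 => ?_⟩⟩
  · rcases h.idx_cases with h₁ | h₂ | h₄
    exacts [Or.inl h₁, Or.inr (Or.inl h₂.1), Or.inr (Or.inr h₄.1)]
  · rintro ⟨S', h, hidx⟩
    rcases h.idx_cases with h₁ | ⟨-, g, hg, hg'⟩ | ⟨h₄, -⟩
    · omega
    · exact h.two_dvd hg hg'
    · omega
  · obtain ⟨a, rfl⟩ := hd2
    rcases Int.even_or_odd' a with ⟨b, rfl | rfl⟩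
    · exact exists_isAdmissible_idx (n := 2) two_pos ![0, 0, 0, 0, 0, 0, 1, 0, 1, 0, 0, 0]
        ![0, 0, 0, 1, 0, 0, -2, 1, -2, -1, 0, 0] (by decide +kernel) (i := 6) rfl
        (s := -8) (c := b - 1) (by decide +kernel)
        (by push_cast; ring)
    · exact exists_isAdmissible_idx (n := 2) two_pos ![0, 0, 0, 0, 1, 0, 0, 0, 0, 0, 0, 0]
        ![0, 0, 1, 0, -2, -1, 0, 0, 0, 0, 0, 0] (by decide +kernel) (i := 4) rfl
        (s := -4) (c := b) (by decide +kernel)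
        (by push_cast; ring)
  · rintro ⟨S', h, hidx⟩
    rcases h.idx_cases with h₁ | ⟨h₂, -⟩ | ⟨-, g, hg, hg'⟩
    · omega
    · omega
    · exact h.mod_sixteen hg hg'
  · rcases hd4 with h | h
    · obtain ⟨q, rfl⟩ : ∃ q, d = 16 * q + 4 := ⟨d / 16, by omega⟩
      exact exists_isAdmissible_idx (n := 4) four_pos ![0, 0, 0, 0, 2, 0, 0, 0, 0, 0, 1, 0]
        ![-1, 0, 0, 1, -2, -1, 0, 0, 0, -1, -6, -3] (by decide +kernel) (i := 10) rfl
        (s := -40) (c := q - 1) (by decide +kernel)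
        (by push_cast; ring)
    · obtain ⟨q, rfl⟩ : ∃ q, d = 16 * q + 12 := ⟨d / 16, by omega⟩
      exact exists_isAdmissible_idx (n := 4) four_pos ![0, 0, 0, 0, 0, 0, 0, 0, 0, 0, 1, 0]
        ![-1, 0, -1, 1, 0, 0, 0, 0, 0, -1, -6, -3] (by decide +kernel) (i := 10) rfl
        (s := -24) (c := q) (by decide +kernel)
        (by push_cast; ring)
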